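/- arXiv:1904.01961 — 3 statements merged into one kernel-verified Lean document; each statement's English description precedes it below -/
import Mathlib

section
/- Let f be a nonnegative operator convex function on [0,∞) with f(0) = 0, and let A ≥ B ≥ 0 be Hermitian matrices. Then Tr((A - B)(f(A) - f(B))) ≥ Tr((A - B) f(A - B)). -/
open Matrix ComplexOrder

/-- `f` is operator convex on `[0, ∞)`: for positive semidefinite matrices `X, Y`
(of any size) and `t ∈ [0, 1]`, `f(tX + (1-t)Y) ≤ t f(X) + (1-t) f(Y)` in the Loewner order. -/
def OperatorConvex (f : ℝ → ℝ) : Prop :=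
  ∀ (k : ℕ) (X Y : Matrix (Fin k) (Fin k) ℂ) (t : ℝ), X.PosSemidef → Y.PosSemidef →
    0 ≤ t → t ≤ 1 →
    (t • cfc f X + (1 - t) • cfc f Y - cfc f (t • X + (1 - t) • Y)).PosSemidef

lemma aux_cont {n : Type*} [Fintype n] [DecidableEq n] (A : Matrix n n ℂ) (f : ℝ → ℝ) :
    ContinuousOn f (spectrum ℝ A) := A.finite_real_spectrum.continuousOn f

lemma aux_cfc_mul {n : Type*} [Fintype n] [DecidableEq n] (A : Matrix n n ℂ) (f g : ℝ → ℝ) :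
    cfc f A * cfc g A = cfc (fun x => f x * g x) A :=
  (cfc_mul f g A (aux_cont A f) (aux_cont A g)).symm

lemma aux_cfc_herm {n : Type*} [Fintype n] [DecidableEq n] (A : Matrix n n ℂ) (f : ℝ → ℝ) :
    (cfc f A)ᴴ = cfc f A := (cfc_predicate f A : IsSelfAdjoint _)

lemma aux_cfc_congr {n : Type*} [Fintype n] [DecidableEq n] {A : Matrix n n ℂ}
    (hA : A.PosSemidef) (f g : ℝ → ℝ) (h : ∀ x, 0 ≤ x → f x = g x) : cfc f A = cfc g A := by
  apply cfc_congr
  intro x hx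
  rw [hA.1.spectrum_real_eq_range_eigenvalues] at hx
  obtain ⟨i, rfl⟩ := hx
  exact h _ (hA.eigenvalues_nonneg i)

lemma aux_cfc_id {n : Type*} [Fintype n] [DecidableEq n] {A : Matrix n n ℂ}
    (hA : A.PosSemidef) (f : ℝ → ℝ) (h : ∀ x, 0 ≤ x → f x = x) : cfc f A = A := by
  rw [aux_cfc_congr hA f (fun x => x) h]
  exact cfc_id' ℝ A hA.1

lemma aux_intertwine {m n : Type*} [Fintype n] [DecidableEq n] [Fintype m] [DecidableEq m]
    (f : ℝ → ℝ) (Y : Matrix m m ℂ) (Z : Matrix n n ℂ) (V : Matrix m n ℂ)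
    (hY : Y.IsHermitian) (hZ : Z.IsHermitian) (h : Y * V = V * Z) :
    cfc f Y * V = V * cfc f Z := by
  classical
  let s : Finset ℝ := Y.finite_real_spectrum.toFinset ∪ Z.finite_real_spectrum.toFinset
  let q : Polynomial ℝ := Lagrange.interpolate s id f
  have hq : ∀ x ∈ s, f x = q.eval x := fun x hx =>
    (Lagrange.eval_interpolate_at_node (v := id) f (Set.injOn_id _) hx).symm
  have h1 : cfc f Y = Polynomial.aeval Y q := by
    rw [← cfc_polynomial q Y hY]
    exact cfc_congr fun x hx => hq x (by simp [s, hx])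
  have h2 : cfc f Z = Polynomial.aeval Z q := by
    rw [← cfc_polynomial q Z hZ]
    exact cfc_congr fun x hx => hq x (by simp [s, hx])
  rw [h1, h2]
  generalize q = q
  induction q using Polynomial.induction_on' with
  | add p q hp hq => simp [Matrix.add_mul, Matrix.mul_add, hp, hq]
  | monomial k a =>
    have hk : Y ^ k * V = V * Z ^ k := by
      induction k with
      | zero => simp
      | succ k ih => rw [pow_succ, Matrix.mul_assoc, h, ← Matrix.mul_assoc, ih, pow_succ,
          Matrix.mul_assoc]
    simp [Polynomial.aeval_monomial, ← Algebra.smul_def, hk]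

lemma aux_jensen {n : Type*} [Fintype n] [DecidableEq n] {f : ℝ → ℝ}
    (hf : OperatorConvex f) {k : ℕ} (X : Matrix (Fin k) (Fin k) ℂ) (hX : X.PosSemidef)
    (V : Matrix (Fin k) n ℂ) (hV : Vᴴ * V = 1) :
    (Vᴴ * cfc f X * V - cfc f (Vᴴ * X * V)).PosSemidef := by
  let W : Matrix (Fin k) (Fin k) ℂ := (2:ℝ) • (V * Vᴴ) - 1
  have hWh : Wᴴ = W := by simp [W]
  have hWV : W * V = V := by
    have : W * V = (2:ℝ) • (V * (Vᴴ * V)) - V := by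
      simp only [W, Matrix.sub_mul, Matrix.smul_mul, Matrix.mul_assoc, Matrix.one_mul]
    rw [this, hV, Matrix.mul_one]
    module
  have hVW : Vᴴ * W = Vᴴ := by
    have := congrArg conjTranspose hWV
    rwa [conjTranspose_mul, hWh] at this
  have hWW : W * W = 1 := by
    have : W * W = (2:ℝ) • ((W * V) * Vᴴ) - W := by
      conv_lhs => enter [2]; simp only [W]
      simp only [Matrix.mul_sub, Matrix.mul_smul, Matrix.mul_assoc, Matrix.mul_one]
    rw [this, hWV]
    simp [W]
  have hY : (W * X * W).PosSemidef := by
    have := hX.mul_mul_conjTranspose_same W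
    rwa [hWh] at this
  have h1 : cfc f (W * X * W) * W = W * cfc f X :=
    aux_intertwine f _ _ _ hY.1 hX.1 (by rw [Matrix.mul_assoc, hWW, Matrix.mul_one])
  have h2 : Vᴴ * cfc f (W * X * W) * V = Vᴴ * cfc f X * V := by
    calc Vᴴ * cfc f (W * X * W) * V = Vᴴ * cfc f (W * X * W) * (W * V) := by rw [hWV]
      _ = Vᴴ * (cfc f (W * X * W) * W) * V := by simp only [Matrix.mul_assoc]
      _ = (Vᴴ * W) * cfc f X * V := by rw [h1]; simp only [Matrix.mul_assoc]
      _ = _ := by rw [hVW]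
  have h0 := hf k X (W * X * W) (1/2) hX hY (by norm_num) (by norm_num)
  set Y0 := (1/2 : ℝ) • X + (1 - 1/2 : ℝ) • (W * X * W) with hY0
  have hY0h : Y0.IsHermitian := by
    have e1 := hX.1.eq
    have e2 := hY.1.eq
    rw [Matrix.IsHermitian, hY0, conjTranspose_add, conjTranspose_smul, conjTranspose_smul, e1, e2]
    simp
  have hZ : (Vᴴ * X * V).PosSemidef := hX.conjTranspose_mul_mul_same V
  have h3 : Y0 * V = V * (Vᴴ * X * V) := by
    have : W * X * W * V = (2:ℝ) • (V * (Vᴴ * X * V)) - X * V := by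
      rw [Matrix.mul_assoc, hWV]
      simp only [W, Matrix.sub_mul, Matrix.smul_mul, Matrix.mul_assoc, Matrix.one_mul]
    rw [hY0, Matrix.add_mul, Matrix.smul_mul, Matrix.smul_mul, this]
    module
  have h4 := aux_intertwine f _ _ _ hY0h hZ.1 h3
  have h5 := h0.conjTranspose_mul_mul_same V
  convert h5 using 1
  rw [Matrix.mul_sub, Matrix.mul_add, Matrix.sub_mul, Matrix.add_mul, Matrix.mul_assoc _ (cfc f Y0),
    h4, ← Matrix.mul_assoc Vᴴ V, hV, Matrix.one_mul]
  simp only [Matrix.mul_smul, Matrix.smul_mul, h2]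
  module

lemma aux_jensen_contr {n : Type*} [Fintype n] [DecidableEq n] {f : ℝ → ℝ}
    (hf : OperatorConvex f) (hf0 : f 0 = 0) (A K : Matrix n n ℂ) (hA : A.PosSemidef)
    (hK : (1 - K * Kᴴ).PosSemidef) :
    (K * cfc f A * Kᴴ - cfc f (K * A * Kᴴ)).PosSemidef := by
  obtain ⟨D, hD⟩ : ∃ D : Matrix n n ℂ, 1 - K * Kᴴ = Dᴴ * D := by
    let s := cfc Real.sqrt (1 - K * Kᴴ)
    refine ⟨s, ?_⟩
    rw [aux_cfc_herm, aux_cfc_mul, aux_cfc_id hK]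
    intro x hx
    exact Real.mul_self_sqrt hx
  let e : Fin (Fintype.card (n ⊕ n)) ≃ n ⊕ n := (Fintype.equivFin (n ⊕ n)).symm
  obtain ⟨J, J', h11, h22, h12⟩ : ∃ J J' : Matrix (Fin (Fintype.card (n ⊕ n))) n ℂ,
      Jᴴ * J = 1 ∧ J'ᴴ * J' = 1 ∧ Jᴴ * J' = 0 := by
    refine ⟨(fromRows 1 0).submatrix e id, (fromRows 0 1).submatrix e id, ?_, ?_, ?_⟩ <;>
    · rw [conjTranspose_submatrix, submatrix_mul_equiv]
      simp [conjTranspose_fromRows_eq_fromCols_conjTranspose, fromCols_mul_fromRows]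
  have h21 : J'ᴴ * J = 0 := by
    have := congrArg conjTranspose h12
    simpa using this
  let V := J * Kᴴ + J' * D
  have hVJ : Vᴴ * J = K := by
    simp [V, Matrix.add_mul, Matrix.mul_assoc, h11, h21]
  have hVJ' : Vᴴ * J' = Dᴴ := by
    simp [V, Matrix.add_mul, Matrix.mul_assoc, h12, h22]
  have hV : Vᴴ * V = 1 := by
    conv_lhs => enter [2]; simp only [V]
    rw [Matrix.mul_add, ← Matrix.mul_assoc, ← Matrix.mul_assoc, hVJ, hVJ', ← hD]
    abel
  let X := J * A * Jᴴ
  have hX : X.PosSemidef := hA.mul_mul_conjTranspose_same J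
  have hXJ : X * J = J * A := by simp [X, Matrix.mul_assoc, h11]
  have hXJ' : X * J' = J' * (0 : Matrix n n ℂ) := by simp [X, Matrix.mul_assoc, h12]
  have g1 := aux_intertwine f _ _ _ hX.1 hA.1 hXJ
  have g2 := aux_intertwine f _ _ _ hX.1 isHermitian_zero hXJ'
  have hz : cfc f (0 : Matrix n n ℂ) = 0 := by
    rw [cfc_apply_zero, hf0, map_zero]
  rw [hz, Matrix.mul_zero] at g2
  have hJV : Jᴴ * V = Kᴴ := by
    have := congrArg conjTranspose hVJ
    simpa using this
  have e1 : Vᴴ * X * V = K * A * Kᴴ := by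
    calc Vᴴ * X * V = (Vᴴ * J) * A * (Jᴴ * V) := by simp only [X, Matrix.mul_assoc]
      _ = _ := by rw [hVJ, hJV]
  have e2 : Vᴴ * cfc f X * V = K * cfc f A * Kᴴ := by
    have : cfc f X * V = J * (cfc f A * Kᴴ) := by
      simp only [V]
      rw [Matrix.mul_add, ← Matrix.mul_assoc, ← Matrix.mul_assoc, g1, g2, Matrix.zero_mul, add_zero,
        Matrix.mul_assoc]
    rw [Matrix.mul_assoc, this, ← Matrix.mul_assoc, hVJ, Matrix.mul_assoc]
  have := aux_jensen hf X hX V hV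
  rwa [e1, e2] at this

lemma aux_contr {n : Type*} [Fintype n] [DecidableEq n] (K : Matrix n n ℂ)
    (h : (1 - Kᴴ * K).PosSemidef) : (1 - K * Kᴴ).PosSemidef := by
  letI : Invertible (1 : Matrix n n ℂ) := invertibleOne
  have h1 := (PosDef.fromBlocks₁₁ K (1 : Matrix n n ℂ) (PosDef.one (n := n) (R := ℂ)))
  have h2 := (PosDef.fromBlocks₂₂ (1 : Matrix n n ℂ) K (PosDef.one (n := n) (R := ℂ)))
  simp only [inv_one, Matrix.mul_one] at h1 h2
  exact h2.1 (h1.2 h)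

lemma aux_mul_trace {n : Type*} [Fintype n] [DecidableEq n] (C M : Matrix n n ℂ)
    (hC : C.PosSemidef) (hM : M.PosSemidef) : 0 ≤ trace (C * M) := by
  have hs : cfc Real.sqrt C * cfc Real.sqrt C = C := by
    rw [aux_cfc_mul]
    exact aux_cfc_id hC _ fun x hx => Real.mul_self_sqrt hx
  have := (hM.mul_mul_conjTranspose_same (cfc Real.sqrt C)).trace_nonneg
  rwa [aux_cfc_herm, trace_mul_cycle, hs] at this

lemma aux_main {n : Type*} [Fintype n] [DecidableEq n] {f : ℝ → ℝ}
    (hf : OperatorConvex f) (hf0 : f 0 = 0) (A C : Matrix n n ℂ) (hA : A.PosSemidef)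
    (hC : C.PosSemidef) (hAC : (A - C).PosSemidef) :
    trace (C * cfc f C) ≤ trace (C * C * cfc (fun x => f x / x) A) := by
  set S := cfc Real.sqrt C with hS
  set T := cfc (fun x => (Real.sqrt x)⁻¹) A with hT
  set P := cfc (fun x : ℝ => x * x⁻¹) A with hP
  have hSh : Sᴴ = S := aux_cfc_herm _ _
  have hTh : Tᴴ = T := aux_cfc_herm _ _
  have hPh : Pᴴ = P := aux_cfc_herm _ _
  have hSS : S * S = C := by
    rw [hS, aux_cfc_mul]
    exact aux_cfc_id hC _ fun x hx => Real.mul_self_sqrt hx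
  have hAid : A = cfc (fun x : ℝ => x) A := (aux_cfc_id hA _ fun x _ => rfl).symm
  have hPP : P * P = P := by
    rw [hP, aux_cfc_mul]
    refine aux_cfc_congr hA _ _ fun x hx => ?_
    by_cases h : x = 0
    · simp [h]
    · field_simp
  have hPA : P * A = A := by
    conv_lhs => rw [hAid]
    rw [hP, aux_cfc_mul]
    refine aux_cfc_id hA _ fun x hx => ?_
    by_cases h : x = 0
    · simp [h]
    · field_simp
  have hTAT : T * A * T = P := by
    conv_lhs => enter [1, 2]; rw [hAid]
    rw [hP, hT, aux_cfc_mul, aux_cfc_mul]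
    refine aux_cfc_congr hA _ _ fun x hx => ?_
    rw [mul_comm, ← mul_assoc, ← mul_inv, Real.mul_self_sqrt hx, mul_comm]
  have hTfT : T * cfc f A * T = cfc (fun x => f x / x) A := by
    rw [hT, aux_cfc_mul, aux_cfc_mul]
    refine aux_cfc_congr hA _ _ fun x hx => ?_
    rw [mul_comm, ← mul_assoc, ← mul_inv, Real.mul_self_sqrt hx, mul_comm, div_eq_mul_inv]
  have hQh : (1 - P)ᴴ = 1 - P := by simp [hPh]
  have hQA : (1 - P) * A = 0 := by rw [Matrix.sub_mul, hPA, Matrix.one_mul, sub_self]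
  have hSQ : S * (1 - P) = 0 := by
    rw [← trace_conjTranspose_mul_self_eq_zero_iff]
    have e : (S * (1 - P))ᴴ * (S * (1 - P)) = (1 - P) * C * (1 - P) := by
      rw [conjTranspose_mul, hSh, hQh, ← hSS]; simp only [Matrix.mul_assoc]
    rw [e]
    apply le_antisymm
    · have h := (hAC.mul_mul_conjTranspose_same (1 - P)).trace_nonneg
      rw [hQh, Matrix.mul_sub (1 - P) A C, hQA, zero_sub, Matrix.neg_mul, trace_neg] at h
      exact neg_nonneg.1 h
    · have h := (hC.mul_mul_conjTranspose_same (1 - P)).trace_nonneg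
      rwa [hQh] at h
  have hSP : S * P = S := by
    rw [Matrix.mul_sub, Matrix.mul_one, sub_eq_zero] at hSQ
    exact hSQ.symm
  have hKh : (S * T)ᴴ = T * S := by rw [conjTranspose_mul, hSh, hTh]
  have hK : (1 - (S * T) * (S * T)ᴴ).PosSemidef := by
    apply aux_contr
    have e : 1 - (S * T)ᴴ * (S * T) = (1 - P) * (1 - P)ᴴ + T * (A - C) * Tᴴ := by
      rw [hKh, hQh, hTh, Matrix.mul_sub T, Matrix.sub_mul (T * A), hTAT, Matrix.mul_sub,
        Matrix.sub_mul 1 P P, hPP, ← hSS]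
      simp only [Matrix.mul_assoc, Matrix.one_mul, Matrix.mul_one]
      abel
    rw [e]
    exact (posSemidef_self_mul_conjTranspose _).add (hAC.mul_mul_conjTranspose_same T)
  have hJ := aux_jensen_contr hf hf0 A (S * T) hA hK
  have e1 : S * T * A * (S * T)ᴴ = C := by
    calc S * T * A * (S * T)ᴴ = S * (T * A * T) * S := by rw [hKh]; simp only [Matrix.mul_assoc]
      _ = C := by rw [hTAT, hSP, hSS]
  have e2 : S * T * cfc f A * (S * T)ᴴ = S * cfc (fun x => f x / x) A * S := by
    rw [hKh, ← hTfT]; simp only [Matrix.mul_assoc]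
  rw [e1, e2] at hJ
  have := aux_mul_trace C _ hC hJ
  rw [Matrix.mul_sub, trace_sub, sub_nonneg] at this
  refine this.trans (le_of_eq ?_)
  rw [← Matrix.mul_assoc, trace_mul_comm]
  congr 1
  simp only [← Matrix.mul_assoc]
  congr 1
  rw [← hSS]; simp only [← Matrix.mul_assoc]

lemma aux_scalar {f : ℝ → ℝ} (hf : OperatorConvex f) (hf0 : f 0 = 0)
    (hfnn : ∀ x, 0 ≤ x → 0 ≤ f x) {b a : ℝ} (hb : 0 ≤ b) (hab : b ≤ a) :
    f b / b ≤ f a / a := by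
  rcases hb.eq_or_lt with rfl | hb
  · simpa using div_nonneg (hfnn a hab) hab
  have ha : 0 < a := hb.trans_le hab
  have hp : ∀ x : ℝ, 0 ≤ x → (algebraMap ℝ (Matrix (Fin 1) (Fin 1) ℂ) x).PosSemidef := by
    intro x hx
    rw [Algebra.algebraMap_eq_smul_one]
    exact PosSemidef.one.smul hx
  have h := hf 1 (algebraMap ℝ _ a) (algebraMap ℝ _ 0) (b / a) (hp a ha.le) (hp 0 le_rfl)
    (by positivity) (by rw [div_le_one ha]; exact hab)
  have e : (b / a) • (algebraMap ℝ (Matrix (Fin 1) (Fin 1) ℂ) a) + (1 - b / a) •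
      (algebraMap ℝ (Matrix (Fin 1) (Fin 1) ℂ) 0) = algebraMap ℝ _ b := by
    rw [map_zero, smul_zero, add_zero, Algebra.smul_def, ← map_mul, div_mul_cancel₀ _ ha.ne']
  rw [e, cfc_algebraMap, cfc_algebraMap, cfc_algebraMap, hf0, map_zero, smul_zero, add_zero,
    Algebra.smul_def, ← map_mul, ← map_sub] at h
  have h' := h.diag_nonneg (i := 0)
  rw [Algebra.algebraMap_eq_smul_one] at h'
  simp only [Matrix.smul_apply, one_apply_eq, Complex.real_smul, mul_one] at h'
  have h'' : 0 ≤ b / a * f a - f b := by exact_mod_cast h'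
  rw [div_le_iff₀ hb]
  have : f a / a * b = b / a * f a := by ring
  linarith

lemma aux_double {n : Type*} [Fintype n] [DecidableEq n] (g : ℝ → ℝ)
    (hg : ∀ a b : ℝ, 0 ≤ b → b ≤ a → g b ≤ g a)
    (A B : Matrix n n ℂ) (hA : A.PosSemidef) (hB : B.PosSemidef) :
    0 ≤ trace ((A - B) * B * (cfc g A - cfc g B)) := by
  set U : Matrix n n ℂ := (hA.1.eigenvectorUnitary : Matrix n n ℂ) with hU
  set W : Matrix n n ℂ := (hB.1.eigenvectorUnitary : Matrix n n ℂ) with hW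
  set a := hA.1.eigenvalues with ha
  set b := hB.1.eigenvalues with hb
  have hUU : Uᴴ * U = 1 := Unitary.coe_star_mul_self hA.1.eigenvectorUnitary
  have hUU' : U * Uᴴ = 1 := Unitary.coe_mul_star_self hA.1.eigenvectorUnitary
  have hWW : Wᴴ * W = 1 := Unitary.coe_star_mul_self hB.1.eigenvectorUnitary
  have hWW' : W * Wᴴ = 1 := Unitary.coe_mul_star_self hB.1.eigenvectorUnitary
  have hcA : ∀ h : ℝ → ℝ, cfc h A = U * diagonal (fun i => (h (a i) : ℂ)) * Uᴴ := by
    intro h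
    rw [hA.1.cfc_eq]; rfl
  have hcB : ∀ h : ℝ → ℝ, cfc h B = W * diagonal (fun i => (h (b i) : ℂ)) * Wᴴ := by
    intro h
    rw [hB.1.cfc_eq]; rfl
  have hAi : A = cfc (fun x : ℝ => x) A := (aux_cfc_id hA _ fun x _ => rfl).symm
  have hBi : B = cfc (fun x : ℝ => x) B := (aux_cfc_id hB _ fun x _ => rfl).symm
  set N := Wᴴ * U with hN
  have key : ∀ h : ℝ → ℝ, Wᴴ * (cfc h A - cfc h B) * U =
      of fun j i => ((h (a i) - h (b j) : ℝ) : ℂ) * N j i := by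
    intro h
    have : Wᴴ * (cfc h A - cfc h B) * U = N * diagonal (fun i => (h (a i) : ℂ)) -
        diagonal (fun i => (h (b i) : ℂ)) * N := by
      rw [hcA, hcB, Matrix.mul_sub, Matrix.sub_mul, hN]
      congr 1
      · simp only [Matrix.mul_assoc, hUU, Matrix.mul_one]
      · simp only [← Matrix.mul_assoc, hWW, Matrix.one_mul]
    rw [this]
    ext j i
    simp only [Matrix.sub_apply, mul_diagonal, diagonal_mul, of_apply]
    push_cast
    ring
  have k1 := key (fun x => x)
  rw [← hAi, ← hBi] at k1
  have k2 := key g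
  have k3 : Uᴴ * (A - B) * W = (Wᴴ * (A - B) * U)ᴴ := by
    simp only [conjTranspose_mul, conjTranspose_sub, conjTranspose_conjTranspose, hA.1.eq, hB.1.eq,
      Matrix.mul_assoc]
  have hBd : B = W * diagonal (fun i => (b i : ℂ)) * Wᴴ := by
    conv_lhs => rw [hBi]
    rw [hcB]
  have e : trace ((A - B) * B * (cfc g A - cfc g B)) =
      trace ((Wᴴ * (A - B) * U)ᴴ * (diagonal (fun i => (b i : ℂ)) *
        (Wᴴ * (cfc g A - cfc g B) * U))) := by
    rw [← k3]
    have : Uᴴ * (A - B) * W * (diagonal (fun i => (b i : ℂ)) * (Wᴴ * (cfc g A - cfc g B) * U)) =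
        Uᴴ * ((A - B) * (W * diagonal (fun i => (b i : ℂ)) * Wᴴ) * (cfc g A - cfc g B)) * U := by
      simp only [Matrix.mul_assoc]
    rw [this, ← hBd, trace_mul_cycle Uᴴ, hUU', Matrix.one_mul]
  rw [e, k1, k2]
  simp only [trace, diag_apply, mul_apply (M := _ᴴ), conjTranspose_apply, diagonal_mul, of_apply]
  refine Finset.sum_nonneg fun i _ => Finset.sum_nonneg fun j _ => ?_
  have hr : star (((a i - b j : ℝ) : ℂ) * N j i) * ((b j : ℂ) * (((g (a i) - g (b j) : ℝ) : ℂ)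
      * N j i)) = ((b j * ((a i - b j) * (g (a i) - g (b j))) : ℝ) : ℂ) * (star (N j i) * N j i) := by
    rw [star_mul', Complex.star_def, Complex.conj_ofReal]
    push_cast
    ring
  rw [hr]
  have hai : 0 ≤ a i := hA.eigenvalues_nonneg i
  have hbj : 0 ≤ b j := hB.eigenvalues_nonneg j
  refine mul_nonneg ?_ (star_mul_self_nonneg _)
  rw [Complex.zero_le_real]
  refine mul_nonneg hbj ?_
  rcases le_total (b j) (a i) with h | h
  · exact mul_nonneg (sub_nonneg.2 h) (sub_nonneg.2 (hg _ _ hbj h))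
  · exact mul_nonneg_of_nonpos_of_nonpos (sub_nonpos.2 h) (sub_nonpos.2 (hg _ _ hai h))

theorem stmt_11 {n : Type*} [Fintype n] [DecidableEq n] (f : ℝ → ℝ)
    (hf : OperatorConvex f) (hf0 : f 0 = 0) (hfnn : ∀ x, 0 ≤ x → 0 ≤ f x)
    (A B : Matrix n n ℂ) (hA : A.PosSemidef) (hB : B.PosSemidef)
    (hAB : (A - B).PosSemidef) :
    Matrix.trace ((A - B) * cfc f (A - B)) ≤
      Matrix.trace ((A - B) * (cfc f A - cfc f B)) := by
  have h1 := aux_main hf hf0 A (A - B) hA hAB (by rwa [sub_sub_cancel])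
  have h2 := aux_double (fun x => f x / x) (fun a b hb hab => aux_scalar hf hf0 hfnn hb hab)
    A B hA hB
  have hfac : ∀ M : Matrix n n ℂ, M.PosSemidef → cfc f M = M * cfc (fun x => f x / x) M := by
    intro M hM
    conv_rhs => enter [1]; rw [(aux_cfc_id hM (fun x : ℝ => x) fun x _ => rfl).symm]
    rw [aux_cfc_mul]
    refine aux_cfc_congr hM _ _ fun x hx => ?_
    by_cases h : x = 0
    · simp [h, hf0]
    · field_simp
  have e : (A - B) * (cfc f A - cfc f B) = (A - B) * (A - B) * cfc (fun x => f x / x) A +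
      (A - B) * B * (cfc (fun x => f x / x) A - cfc (fun x => f x / x) B) := by
    rw [hfac A hA, hfac B hB]
    noncomm_ring
  rw [e, trace_add]
  exact h1.trans (le_add_of_nonneg_right h2)
end

section
/- For p ∈ [1/2, 1] and positive semidefinite matrices A, B: Tr(A + B - |A - B|) ≤ 2 Tr(A^s B^(1-s)) with s = 1/p applied to A^p, B^p yields Tr(A^p + B^p - |A^p - B^p|) ≤ Tr(A B^(p-1)) + Tr(B A^(p-1)) for p ≥ 1; equivalently, Tr(|A^p - B^p|) ≥ Tr((A - B)(A^(p-1) - B^(p-1))). -/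
open Matrix ComplexOrder

noncomputable def matAbs {n : Type*} [Fintype n] [DecidableEq n] (X : Matrix n n ℂ) :
    Matrix n n ℂ := cfc Real.sqrt (Xᴴ * X)

section aux
variable {R : Type*} [CStarAlgebra R] [PartialOrder R] [StarOrderedRing R]

lemma aux_rpow_mul (X : R) (hX : 0 ≤ X) (s t : ℝ) (hs : 0 ≤ s) (ht : 0 ≤ t) (hst : s + t = 1) :
    X ^ s * X ^ t = X := by
  rw [CFC.rpow_eq_cfc_real hX, CFC.rpow_eq_cfc_real hX, ← cfc_mul
    (hf := (Real.continuous_rpow_const hs).continuousOn)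
    (hg := (Real.continuous_rpow_const ht).continuousOn)]
  conv_rhs => rw [← cfc_id' ℝ X]
  refine cfc_congr fun x hx => ?_
  have hx0 : 0 ≤ x := spectrum_nonneg_of_nonneg hX hx
  change x ^ s * x ^ t = x
  rw [← Real.rpow_add_of_nonneg hx0 hs ht, hst, Real.rpow_one]

lemma aux_audenaert (τ : R →+ ℂ) (hτ : ∀ a b : R, 0 ≤ a → 0 ≤ b → 0 ≤ τ (a * b))
    (X Y P : R) (hX : 0 ≤ X) (hY : 0 ≤ Y) (hP : 0 ≤ P) (hXYP : X ≤ Y + P)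
    (s t : ℝ) (hs : 0 ≤ s) (ht : 0 ≤ t) (hst : s + t = 1) :
    0 ≤ τ P - τ X + τ (X ^ s * Y ^ t) := by
  have hs' : s ∈ Set.Icc (0:ℝ) 1 := ⟨hs, by linarith⟩
  have ht' : t ∈ Set.Icc (0:ℝ) 1 := ⟨ht, by linarith⟩
  have hYZ : Y ≤ Y + P := le_add_of_nonneg_right hP
  have hZ : 0 ≤ Y + P := add_nonneg hY hP
  have h1 := hτ (X ^ s) ((Y + P) ^ t - X ^ t) CFC.rpow_nonneg
    (sub_nonneg.2 (CFC.rpow_le_rpow ht' hXYP))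
  have h2 := hτ ((Y + P) ^ s - X ^ s) ((Y + P) ^ t - Y ^ t)
    (sub_nonneg.2 (CFC.rpow_le_rpow hs' hXYP)) (sub_nonneg.2 (CFC.rpow_le_rpow ht' hYZ))
  have h3 := hτ ((Y + P) ^ s - Y ^ s) (Y ^ t)
    (sub_nonneg.2 (CFC.rpow_le_rpow hs' hYZ)) CFC.rpow_nonneg
  have h := add_nonneg (add_nonneg h1 h2) h3
  simp only [mul_sub, sub_mul, map_sub, aux_rpow_mul X hX s t hs ht hst,
    aux_rpow_mul Y hY s t hs ht hst, aux_rpow_mul _ hZ s t hs ht hst, map_add] at h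
  convert h using 1
  ring

lemma aux_main_s17 (τ : R →+ ℂ) (hτ : ∀ a b : R, 0 ≤ a → 0 ≤ b → 0 ≤ τ (a * b))
    (p : ℝ) (hp : 1 ≤ p) (A B : R) (hA : 0 ≤ A) (hB : 0 ≤ B) :
    τ (cfc (fun x : ℝ => x ^ p) A + cfc (fun x : ℝ => x ^ p) B -
        cfc Real.sqrt (star (cfc (fun x : ℝ => x ^ p) A - cfc (fun x : ℝ => x ^ p) B) *
          (cfc (fun x : ℝ => x ^ p) A - cfc (fun x : ℝ => x ^ p) B))) ≤
      τ (A * cfc (fun x : ℝ => x ^ (p - 1)) B) + τ (B * cfc (fun x : ℝ => x ^ (p - 1)) A) := by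
  have hp0 : 0 < p := by linarith
  have hs : (0:ℝ) ≤ 1 / p := by positivity
  have ht : 0 ≤ 1 - 1 / p := by
    rw [sub_nonneg, div_le_one hp0]; exact hp
  have key : ∀ C : R, 0 ≤ C → (C ^ p) ^ (1 / p) = C ∧ (C ^ p) ^ (1 - 1 / p) = C ^ (p - 1) := by
    intro C hC
    constructor
    · rw [CFC.rpow_rpow_of_exponent_nonneg C p (1 / p) hp0.le hs hC,
        mul_one_div_cancel hp0.ne', CFC.rpow_one C hC]
    · rw [CFC.rpow_rpow_of_exponent_nonneg C p (1 - 1 / p) hp0.le ht hC, mul_sub,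
        mul_one_div_cancel hp0.ne', mul_one]
  simp only [← CFC.rpow_eq_cfc_real hA, ← CFC.rpow_eq_cfc_real hB]
  have hX : 0 ≤ A ^ p := CFC.rpow_nonneg
  have hY : 0 ≤ B ^ p := CFC.rpow_nonneg
  obtain ⟨kA1, kA2⟩ := key A hA
  obtain ⟨kB1, kB2⟩ := key B hB
  generalize A ^ p = X at *
  generalize B ^ p = Y at *
  have hD : IsSelfAdjoint (X - Y) := hX.isSelfAdjoint.sub hY.isSelfAdjoint
  have habs : cfc Real.sqrt (star (X - Y) * (X - Y)) = (X - Y)⁺ + (X - Y)⁻ := by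
    rw [CFC.posPart_add_negPart (X - Y) hD, CFC.abs,
      CFC.sqrt_eq_real_sqrt _ (star_mul_self_nonneg _), cfcₙ_eq_cfc]
  have hpm := CFC.posPart_sub_negPart (X - Y) hD
  have hpos : 0 ≤ (X - Y)⁺ := CFC.posPart_nonneg _
  have hneg : 0 ≤ (X - Y)⁻ := CFC.negPart_nonneg _
  rw [habs]
  generalize (X - Y)⁺ = P at *
  generalize (X - Y)⁻ = N at *
  have e1 : Y + P = X + N := by
    have : Y + P - (X + N) = (P - N) - (X - Y) := by abel
    rw [hpm, sub_self] at this
    exact sub_eq_zero.1 this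
  have h1 := aux_audenaert τ hτ X Y P hX hY hpos (e1 ▸ le_add_of_nonneg_right hneg)
    _ _ hs ht (by ring)
  have h2 := aux_audenaert τ hτ Y X N hY hX hneg (e1 ▸ le_add_of_nonneg_right hpos)
    _ _ hs ht (by ring)
  rw [kA1, kB2] at h1
  rw [kB1, kA2] at h2
  rw [← sub_nonneg]
  convert add_nonneg h1 h2 using 1
  simp only [map_add, map_sub]
  ring

end aux

section aux2
open scoped Matrix.Norms.L2Operator MatrixOrder

lemma aux_trace {n : Type*} [Fintype n] [DecidableEq n] (a b : Matrix n n ℂ)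
    (ha : a.PosSemidef) (hb : b.PosSemidef) : 0 ≤ Matrix.trace (a * b) := by
  obtain ⟨c, rfl⟩ := CStarAlgebra.nonneg_iff_eq_star_mul_self.1 (Matrix.nonneg_iff_posSemidef.2 ha)
  rw [mul_assoc, Matrix.trace_mul_comm]
  exact (hb.mul_mul_conjTranspose_same c).trace_nonneg

lemma aux_mat {n : Type*} [Fintype n] [DecidableEq n] (p : ℝ) (hp : 1 ≤ p)
    (A B : Matrix n n ℂ) (hA : A.PosSemidef) (hB : B.PosSemidef) :
    Matrix.trace (cfc (fun x : ℝ => x ^ p) A + cfc (fun x : ℝ => x ^ p) B -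
        matAbs (cfc (fun x : ℝ => x ^ p) A - cfc (fun x : ℝ => x ^ p) B)) ≤
      Matrix.trace (A * cfc (fun x : ℝ => x ^ (p - 1)) B) +
        Matrix.trace (B * cfc (fun x : ℝ => x ^ (p - 1)) A) :=
  aux_main_s17 (Matrix.traceAddMonoidHom n ℂ)
    (fun a b ha hb => aux_trace a b (Matrix.nonneg_iff_posSemidef.1 ha)
      (Matrix.nonneg_iff_posSemidef.1 hb)) p hp A B
    (Matrix.nonneg_iff_posSemidef.2 hA) (Matrix.nonneg_iff_posSemidef.2 hB)

end aux2

theorem stmt_17 {n : Type*} [Fintype n] [DecidableEq n] (p : ℝ) (hp : 1 ≤ p)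
    (A B : Matrix n n ℂ) (hA : A.PosSemidef) (hB : B.PosSemidef) :
    Matrix.trace (cfc (fun x : ℝ => x ^ p) A + cfc (fun x : ℝ => x ^ p) B -
        matAbs (cfc (fun x : ℝ => x ^ p) A - cfc (fun x : ℝ => x ^ p) B)) ≤
      Matrix.trace (A * cfc (fun x : ℝ => x ^ (p - 1)) B) +
        Matrix.trace (B * cfc (fun x : ℝ => x ^ (p - 1)) A) :=
  aux_mat p hp A B hA hB
end

section
/- For p ∈ [1, 2] and positive semidefinite matrices A, B, the chain Tr(|A^p - B^p|) ≥ Tr(|A - B|^p) ≥ Tr((A - B)(A^(p-1) - B^(p-1))) holds. -/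
open Matrix ComplexOrder

section helpers

variable {n : Type*} [Fintype n] [DecidableEq n]

open scoped MatrixOrder in
theorem psd_sqrt {X : Matrix n n ℂ} (hX : X.PosSemidef) :
    ∃ R : Matrix n n ℂ, Rᴴ = R ∧ X = R * R := by
  have h := CFC.sqrt_mul_sqrt_self X hX.nonneg
  refine ⟨CFC.sqrt X, ?_, h.symm⟩
  exact (CFC.sqrt_nonneg X).posSemidef.isHermitian

theorem tr_nonneg {X : Matrix n n ℂ} (hX : X.PosSemidef) : 0 ≤ (trace X).re :=
  (Complex.le_def.1 hX.trace_nonneg).1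

theorem tr_mul_nonneg {X Y : Matrix n n ℂ} (hX : X.PosSemidef) (hY : Y.PosSemidef) :
    0 ≤ (trace (X * Y)).re := by
  obtain ⟨R, hR, rfl⟩ := psd_sqrt hX
  have := hY.mul_mul_conjTranspose_same R
  rw [hR] at this
  have h2 := tr_nonneg this
  rwa [trace_mul_comm, ← mul_assoc] at h2

theorem tr_mul_mono {X Y Z : Matrix n n ℂ} (hX : X.PosSemidef) (hY : (Z - Y).PosSemidef) :
    (trace (X * Y)).re ≤ (trace (X * Z)).re := by
  have := tr_mul_nonneg hX hY
  rw [mul_sub, trace_sub, Complex.sub_re] at this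
  linarith

theorem inv_anti {X D : Matrix n n ℂ} (hX : X.PosDef) (hD : D.PosSemidef) :
    (X⁻¹ - (X + D)⁻¹).PosSemidef := by
  have hY : (X + D).PosDef := hX.add_posSemidef hD
  have uX := (Matrix.isUnit_iff_isUnit_det _).1 hX.isUnit
  have uY := (Matrix.isUnit_iff_isUnit_det _).1 hY.isUnit
  have hYi := hY.inv.isHermitian
  have e : X⁻¹ - (X + D)⁻¹ = (X + D)⁻¹ * D * ((X + D)⁻¹)ᴴ
      + (X + D)⁻¹ * (D * X⁻¹ * Dᴴ) * ((X + D)⁻¹)ᴴ := by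
    rw [hYi.eq, hD.isHermitian.eq]
    have e1 : D + D * X⁻¹ * D = (X + D) * X⁻¹ * (X + D) - (X + D) := by
      simp only [add_mul, mul_add, Matrix.mul_nonsing_inv _ uX, one_mul,
        Matrix.nonsing_inv_mul_cancel_right _ _ uX]
      abel
    rw [← add_mul, ← mul_add, e1, mul_sub, sub_mul]
    simp only [mul_assoc, Matrix.mul_nonsing_inv _ uY, mul_one]
    rw [← mul_assoc, Matrix.nonsing_inv_mul _ uY, one_mul]
  rw [e]
  exact (hD.mul_mul_conjTranspose_same _).add
    ((hX.inv.posSemidef.mul_mul_conjTranspose_same _).mul_mul_conjTranspose_same _)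

theorem inv_conv {X D : Matrix n n ℂ} (hX : X.PosDef) (hD : D.PosSemidef) :
    ((X + D)⁻¹ - X⁻¹ + X⁻¹ * D * X⁻¹).PosSemidef := by
  have hY : (X + D).PosDef := hX.add_posSemidef hD
  have uX := (Matrix.isUnit_iff_isUnit_det _).1 hX.isUnit
  have uY := (Matrix.isUnit_iff_isUnit_det _).1 hY.isUnit
  have hXi := hX.inv.isHermitian
  have e : (X + D)⁻¹ - X⁻¹ + X⁻¹ * D * X⁻¹ = X⁻¹ * (D * (X + D)⁻¹ * Dᴴ) * (X⁻¹)ᴴ := by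
    rw [hXi.eq, hD.isHermitian.eq]
    have e1 : D * (X + D)⁻¹ * D = X * (X + D)⁻¹ * X - X + D := by
      have : D = (X + D) - X := by abel
      generalize hYY : X + D = Y at *
      subst this
      simp only [sub_mul, mul_sub, Matrix.mul_nonsing_inv _ uY, one_mul,
        Matrix.nonsing_inv_mul_cancel_right _ _ uY]
      abel
    rw [e1]
    simp only [mul_add, mul_sub, add_mul, sub_mul, mul_assoc, Matrix.mul_nonsing_inv _ uX, mul_one,
      Matrix.nonsing_inv_mul_cancel_left _ _ uX]
  rw [e]
  exact ((hY.inv.posSemidef.mul_mul_conjTranspose_same _).mul_mul_conjTranspose_same _)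

theorem tr_h_mono {W D : Matrix n n ℂ} (hW : W.PosSemidef) (hD : D.PosSemidef) :
    (trace ((1 + W)⁻¹ - (1 + W + D)⁻¹)).re ≤ (trace D).re := by
  have hX : (1 + W).PosDef := PosDef.one.add_posSemidef hW
  have uX := (Matrix.isUnit_iff_isUnit_det _).1 hX.isUnit
  have h1 := tr_nonneg (inv_conv hX hD)
  have h2 := inv_anti PosDef.one hW
  rw [inv_one] at h2
  have h3 := tr_mul_nonneg hD h2
  have h4 := hW.mul_mul_conjTranspose_same ((1 + W)⁻¹)
  rw [hX.inv.isHermitian.eq] at h4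
  have h5 := tr_mul_nonneg hD h4
  have e : (1 + W)⁻¹ * W * (1 + W)⁻¹ = (1 + W)⁻¹ - (1 + W)⁻¹ * (1 + W)⁻¹ := by
    have : W = (1 + W) - 1 := by abel
    generalize 1 + W = X at *
    subst this
    simp only [sub_mul, mul_sub, Matrix.nonsing_inv_mul _ uX, one_mul, mul_one]
  rw [e] at h5
  have e2 : trace ((1 + W)⁻¹ * D * (1 + W)⁻¹) = trace (D * ((1 + W)⁻¹ * (1 + W)⁻¹)) := by
    rw [mul_assoc, trace_mul_comm, mul_assoc]
  simp only [mul_sub, mul_one, trace_add, trace_sub, e2, Complex.add_re, Complex.sub_re] at *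
  linarith

theorem g_ident {R Y : Matrix n n ℂ} (hR : Rᴴ = R) (hY : Y.PosDef) :
    trace (R * R * (Y⁻¹ - (Y + R * R)⁻¹)) =
      trace (R * Y⁻¹ * R - 1 + (1 + R * Y⁻¹ * R)⁻¹) := by
  have hP : (R * R).PosSemidef := by
    have := posSemidef_self_mul_conjTranspose R
    rwa [hR] at this
  have hZ : (Y + R * R).PosDef := hY.add_posSemidef hP
  have uY := (Matrix.isUnit_iff_isUnit_det _).1 hY.isUnit
  have uZ := (Matrix.isUnit_iff_isUnit_det _).1 hZ.isUnit
  have e : (1 + R * Y⁻¹ * R)⁻¹ = 1 - R * (Y + R * R)⁻¹ * R := by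
    apply Matrix.inv_eq_left_inv
    have e2 : (Y + R * R)⁻¹ * (Y * Y⁻¹ + R * R * Y⁻¹) = Y⁻¹ := by
      rw [← add_mul, ← mul_assoc, Matrix.nonsing_inv_mul _ uZ, one_mul]
    rw [Matrix.mul_nonsing_inv _ uY] at e2
    calc (1 - R * (Y + R * R)⁻¹ * R) * (1 + R * Y⁻¹ * R)
        = 1 + R * Y⁻¹ * R - R * ((Y + R * R)⁻¹ * (1 + R * R * Y⁻¹)) * R := by
          noncomm_ring
      _ = 1 := by rw [e2]; abel
  rw [e]
  have e3 : R * Y⁻¹ * R - 1 + (1 - R * (Y + R * R)⁻¹ * R) = R * (Y⁻¹ - (Y + R * R)⁻¹) * R := by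
    noncomm_ring
  rw [e3, trace_mul_comm (R * _) R, ← mul_assoc]

theorem posDef_t {t : ℝ} (ht : 0 < t) : (t • (1 : Matrix n n ℂ)).PosDef :=
  PosDef.one.smul ht

theorem t_inv {t : ℝ} (ht : 0 < t) : (t • (1 : Matrix n n ℂ))⁻¹ = t⁻¹ • 1 := by
  apply Matrix.inv_eq_left_inv
  simp [smul_smul, ht.ne']

theorem second_core {t : ℝ} (ht : 0 < t) {B P : Matrix n n ℂ} (hB : B.PosSemidef)
    (hP : P.PosSemidef) :
    (trace (P * ((t • 1 + B)⁻¹ - (t • 1 + B + P)⁻¹))).re ≤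
      (trace (P * ((t • 1)⁻¹ - (t • 1 + P)⁻¹))).re := by
  obtain ⟨R, hR, rfl⟩ := psd_sqrt hP
  have hT := posDef_t (n := n) ht
  have hY := hT.add_posSemidef hB
  rw [g_ident hR hY, g_ident hR hT]
  have hW := hY.inv.posSemidef.mul_mul_conjTranspose_same R
  have hD := (inv_anti hT hB).mul_mul_conjTranspose_same R
  rw [hR] at hW hD
  have := tr_h_mono hW hD
  have e : 1 + R * (t • 1 + B)⁻¹ * R + R * ((t • 1)⁻¹ - (t • 1 + B)⁻¹) * R
      = 1 + R * (t • 1)⁻¹ * R := by noncomm_ring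
  rw [e, mul_sub, sub_mul] at this
  simp only [trace_add, trace_sub, Complex.add_re, Complex.sub_re] at *
  linarith

theorem mul_res {t : ℝ} (ht : 0 < t) {B : Matrix n n ℂ} (hB : B.PosSemidef) :
    B * (t • 1 + B)⁻¹ = 1 - t • (t • 1 + B)⁻¹ := by
  have hY := (posDef_t (n := n) ht).add_posSemidef hB
  have uY := (Matrix.isUnit_iff_isUnit_det _).1 hY.isUnit
  rw [eq_sub_iff_add_eq]
  have : B * (t • 1 + B)⁻¹ + t • (t • 1 + B)⁻¹ = (t • 1 + B) * (t • 1 + B)⁻¹ := by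
    rw [add_mul, smul_mul_assoc, one_mul, add_comm]
  rw [this, Matrix.mul_nonsing_inv _ uY]

theorem first_core {t : ℝ} (ht : 0 < t) {B P : Matrix n n ℂ} (hB : B.PosSemidef)
    (hP : P.PosSemidef) :
    t * (trace ((t • 1 + B)⁻¹ - (t • 1 + B + P)⁻¹)).re ≤
      (trace (1 - t • (t • 1 + P)⁻¹)).re := by
  have hT := posDef_t (n := n) ht
  have h1 := mul_res ht (hB.add hP)
  have h2 := mul_res ht hB
  have h3 := mul_res ht hP
  have h4 := tr_mul_mono hB (inv_anti (hT.add_posSemidef hB) hP)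
  have h5 := tr_mul_mono hP (inv_anti (hT.add_posSemidef hP) hB)
  rw [add_assoc, add_comm P B] at h5
  rw [add_assoc] at h4 ⊢
  rw [add_mul] at h1
  rw [h2] at h4
  rw [h3] at h5
  have h6 := congrArg (fun X => (trace X).re) h1
  simp only [trace_add, trace_sub, trace_smul, Complex.add_re, Complex.sub_re, Complex.smul_re,
    smul_eq_mul] at *
  linarith

theorem co (f : ℝ → ℝ) (A : Matrix n n ℂ) : ContinuousOn f (spectrum ℝ A) :=
  (Matrix.finite_real_spectrum (A := A)).continuousOn f

theorem cfc_herm (f : ℝ → ℝ) (A : Matrix n n ℂ) : (cfc f A).IsHermitian :=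
  cfc_predicate (R := ℝ) (p := IsSelfAdjoint) f A

theorem spec_nonneg {A : Matrix n n ℂ} (hA : A.PosSemidef) {x : ℝ} (hx : x ∈ spectrum ℝ A) :
    0 ≤ x := by
  rw [hA.isHermitian.spectrum_real_eq_range_eigenvalues] at hx
  obtain ⟨i, rfl⟩ := hx
  exact hA.eigenvalues_nonneg i

open scoped MatrixOrder in
theorem cfc_psd {f : ℝ → ℝ} {A : Matrix n n ℂ} (h : ∀ x, 0 ≤ f x) : (cfc f A).PosSemidef :=
  (cfc_nonneg (fun x _ => h x) : 0 ≤ cfc f A).posSemidef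

theorem functional {H : Matrix n n ℂ} (hH : H.IsHermitian) (M : Matrix n n ℂ) :
    ∃ w : n → ℝ, ∀ f : ℝ → ℝ,
      (trace (M * cfc f H)).re = ∑ i, w i * f (hH.eigenvalues i) := by
  let V : Matrix n n ℂ := hH.eigenvectorUnitary
  refine ⟨fun i => ((star V * M * V) i i).re, fun f => ?_⟩
  rw [hH.cfc_eq, Matrix.IsHermitian.cfc, Unitary.conjStarAlgAut_apply]
  change (trace (M * (V * diagonal _ * star V))).re = _
  rw [← mul_assoc, trace_mul_comm, ← mul_assoc, ← mul_assoc, trace, Complex.re_sum]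
  refine Finset.sum_congr rfl fun i _ => ?_
  simp [Matrix.mul_diagonal]

theorem key_scalar_lt {ι : Type*} [Fintype ι] (w x : ι → ℝ) (hx : ∀ i, 0 ≤ x i)
    (h : ∀ t : ℝ, 0 < t → 0 ≤ ∑ i, w i * (x i / (t + x i))) {r : ℝ} (hr : r ∈ Set.Ioo (0 : ℝ) 1) :
    0 ≤ ∑ i, w i * x i ^ r := by
  obtain ⟨μ, hμ⟩ := Real.exists_measure_rpow_eq_integral_rpowIntegrand₀₁ hr
  have e : ∑ i, w i * x i ^ r =
      ∫ t in Set.Ioi 0, ∑ i, w i * Real.rpowIntegrand₀₁ r t (x i) ∂μ := by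
    rw [MeasureTheory.integral_finsetSum]
    · refine Finset.sum_congr rfl fun i _ => ?_
      rw [MeasureTheory.integral_const_mul, (hμ (x i) (hx i)).2]
    · intro i _
      exact (hμ (x i) (hx i)).1.const_mul _
  rw [e]
  refine MeasureTheory.setIntegral_nonneg measurableSet_Ioi fun t ht => ?_
  have ht : 0 < t := ht
  have e2 : ∑ i, w i * Real.rpowIntegrand₀₁ r t (x i) =
      t ^ r * t⁻¹ * ∑ i, w i * (x i / (t + x i)) := by
    rw [Finset.mul_sum]
    refine Finset.sum_congr rfl fun i _ => ?_
    have : t + x i ≠ 0 := by have := hx i; positivity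
    rw [Real.rpowIntegrand₀₁]
    field_simp
    ring
  rw [e2]
  exact mul_nonneg (by positivity) (h t ht)

theorem key_scalar {ι : Type*} [Fintype ι] (w x : ι → ℝ) (hx : ∀ i, 0 ≤ x i)
    (h : ∀ t : ℝ, 0 < t → 0 ≤ ∑ i, w i * (x i / (t + x i))) {r : ℝ} (hr : 0 < r) (hr1 : r ≤ 1) :
    0 ≤ ∑ i, w i * x i ^ r := by
  rcases hr1.lt_or_eq with h1 | rfl
  · exact key_scalar_lt w x hx h ⟨hr, h1⟩
  · have hc : ContinuousAt (fun r : ℝ => ∑ i, w i * x i ^ r) 1 := by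
      refine tendsto_finsetSum _ fun i _ => ?_
      exact (Real.continuousAt_const_rpow' one_ne_zero).const_mul _
    refine ge_of_tendsto (hc.tendsto.mono_left (nhdsWithin_le_nhds (s := Set.Iio 1))) ?_
    filter_upwards [Ioo_mem_nhdsLT (show (0 : ℝ) < 1 by norm_num)] with s hs
    exact key_scalar_lt w x hx h hs

theorem key_mat {H₁ H₂ H₃ : Matrix n n ℂ} (h₁ : H₁.PosSemidef) (h₂ : H₂.PosSemidef)
    (h₃ : H₃.PosSemidef) (M₁ M₂ M₃ : Matrix n n ℂ)
    (h : ∀ t : ℝ, 0 < t → 0 ≤ (trace (M₁ * cfc (fun x : ℝ => x / (t + x)) H₁)).re +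
      ((trace (M₂ * cfc (fun x : ℝ => x / (t + x)) H₂)).re +
      (trace (M₃ * cfc (fun x : ℝ => x / (t + x)) H₃)).re)) {r : ℝ} (hr : 0 < r) (hr1 : r ≤ 1) :
    0 ≤ (trace (M₁ * cfc (fun x : ℝ => x ^ r) H₁)).re +
      ((trace (M₂ * cfc (fun x : ℝ => x ^ r) H₂)).re +
      (trace (M₃ * cfc (fun x : ℝ => x ^ r) H₃)).re) := by
  obtain ⟨w₁, e₁⟩ := functional h₁.isHermitian M₁
  obtain ⟨w₂, e₂⟩ := functional h₂.isHermitian M₂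
  obtain ⟨w₃, e₃⟩ := functional h₃.isHermitian M₃
  have := key_scalar (ι := n ⊕ (n ⊕ n)) (Sum.elim w₁ (Sum.elim w₂ w₃))
    (Sum.elim h₁.isHermitian.eigenvalues (Sum.elim h₂.isHermitian.eigenvalues
      h₃.isHermitian.eigenvalues)) ?_ ?_ hr hr1
  · simpa [e₁, e₂, e₃, Fintype.sum_sum_type] using this
  · rintro (i | i | i)
    · exact h₁.eigenvalues_nonneg i
    · exact h₂.eigenvalues_nonneg i
    · exact h₃.eigenvalues_nonneg i
  · intro t ht
    simpa [e₁, e₂, e₃, Fintype.sum_sum_type] using h t ht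

theorem k_eq {t : ℝ} (ht : 0 < t) {A : Matrix n n ℂ} (hA : A.PosSemidef) :
    cfc (fun x : ℝ => x / (t + x)) A = 1 - t • (t • 1 + A)⁻¹ := by
  have hs : IsSelfAdjoint A := hA.isHermitian
  have hY := (posDef_t (n := n) ht).add_posSemidef hA
  have uY := (Matrix.isUnit_iff_isUnit_det _).1 hY.isUnit
  rw [← mul_res ht hA]
  have e : cfc (fun x : ℝ => x / (t + x)) A * (t • 1 + A) = A := by
    have e1 : t • 1 + A = cfc (fun x : ℝ => t + x) A := by
      rw [cfc_const_add t (fun x => x) A (co _ _), cfc_id' ℝ A, Algebra.algebraMap_eq_smul_one]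
    rw [e1, ← cfc_mul _ _ A (co _ _) (co _ _)]
    conv_rhs => rw [← cfc_id' ℝ A]
    refine cfc_congr fun x hx => ?_
    have := spec_nonneg hA hx
    have : t + x ≠ 0 := by positivity
    field_simp
  calc _ = cfc (fun x : ℝ => x / (t + x)) A * (t • 1 + A) * (t • 1 + A)⁻¹ := by
        rw [Matrix.mul_nonsing_inv_cancel_right _ _ uY]
    _ = _ := by rw [e]

theorem rpow_split {A : Matrix n n ℂ} (hA : A.PosSemidef) {p : ℝ} (hp : 1 < p) :
    cfc (fun x : ℝ => x ^ p) A = A * cfc (fun x : ℝ => x ^ (p - 1)) A := by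
  have hs : IsSelfAdjoint A := hA.isHermitian
  have : A * cfc (fun x : ℝ => x ^ (p - 1)) A =
      cfc (fun x : ℝ => x) A * cfc (fun x : ℝ => x ^ (p - 1)) A := by rw [cfc_id' ℝ A]
  rw [this, ← cfc_mul _ _ A (co _ _) (co _ _)]
  refine cfc_congr fun x hx => ?_
  have h0 := spec_nonneg hA hx
  rcases h0.eq_or_lt with rfl | h
  · simp [Real.zero_rpow (show p ≠ 0 by linarith)]
  · rw [Real.rpow_sub_one h.ne']
    field_simp

theorem matAbs_eq {S : Matrix n n ℂ} (hS : S.IsHermitian) : matAbs S = cfc (fun x : ℝ => |x|) S := by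
  have hs : IsSelfAdjoint S := hS
  have e : Sᴴ * S = cfc (fun x : ℝ => x * x) S := by
    rw [cfc_mul _ _ S (co _ _) (co _ _), cfc_id' ℝ S, hS.eq]
  rw [matAbs, e, ← cfc_comp' Real.sqrt (fun x : ℝ => x * x) S
    (by fun_prop) (co _ _)]
  simp only [Real.sqrt_mul_self_eq_abs]

theorem cfc_cfc (f g : ℝ → ℝ) {S : Matrix n n ℂ} (hS : S.IsHermitian) :
    cfc f (cfc g S) = cfc (fun x => f (g x)) S := by
  have hs : IsSelfAdjoint S := hS
  rw [← cfc_comp' f g S ((Set.Finite.image _ (Matrix.finite_real_spectrum (A := S))).continuousOn f)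
    (co _ _)]

theorem tr_im {X : Matrix n n ℂ} (hX : X.IsHermitian) : (trace X).im = 0 := by
  have := trace_conjTranspose X
  rw [hX.eq] at this
  exact Complex.conj_eq_iff_im.1 this.symm

theorem tr_mul_im {X Y : Matrix n n ℂ} (hX : X.IsHermitian) (hY : Y.IsHermitian) :
    (trace (X * Y)).im = 0 := by
  have := trace_conjTranspose (X * Y)
  rw [conjTranspose_mul, hX.eq, hY.eq, trace_mul_comm] at this
  exact Complex.conj_eq_iff_im.1 this.symm

theorem half {t : ℝ} (ht : 0 < t) {A B P N Q : Matrix n n ℂ} (hA : A.PosSemidef)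
    (hB : B.PosSemidef) (hN : N.PosSemidef) (hQ : Q.PosSemidef)
    (e : A + N = B + P) :
    (trace (Q * cfc (fun x : ℝ => x / (t + x)) A)).re
      - (trace (Q * cfc (fun x : ℝ => x / (t + x)) B)).re ≤
      t * (trace (Q * ((t • 1 + B)⁻¹ - (t • 1 + B + P)⁻¹))).re := by
  have hT := posDef_t (n := n) ht
  have h := tr_mul_mono hQ (inv_anti (hT.add_posSemidef hA) hN)
  rw [add_assoc, e, ← add_assoc] at h
  rw [k_eq ht hA, k_eq ht hB]
  simp only [mul_sub, mul_one, trace_sub, Complex.sub_re, mul_smul_comm, trace_smul,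
    Complex.smul_re, smul_eq_mul] at *
  nlinarith

theorem half_first {t : ℝ} (ht : 0 < t) {A B P N Q : Matrix n n ℂ} (hA : A.PosSemidef)
    (hB : B.PosSemidef) (hP : P.PosSemidef) (hN : N.PosSemidef) (hQ : Q.PosSemidef)
    (hQ1 : (1 - Q).PosSemidef) (e : A + N = B + P) :
    (trace (Q * cfc (fun x : ℝ => x / (t + x)) A)).re
      - (trace (Q * cfc (fun x : ℝ => x / (t + x)) B)).re ≤
      (trace (cfc (fun x : ℝ => x / (t + x)) P)).re := by
  have hT := posDef_t (n := n) ht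
  refine (half ht hA hB hN hQ e).trans ?_
  have h1 := first_core ht hB hP
  have h2 := tr_mul_nonneg hQ1 (inv_anti (hT.add_posSemidef hB) hP)
  rw [k_eq ht hP]
  refine le_trans ?_ h1
  rw [sub_mul, one_mul, trace_sub, Complex.sub_re] at h2
  exact mul_le_mul_of_nonneg_left (by linarith) ht.le

theorem half_second {t : ℝ} (ht : 0 < t) {A B P N : Matrix n n ℂ} (hA : A.PosSemidef)
    (hB : B.PosSemidef) (hP : P.PosSemidef) (hN : N.PosSemidef) (e : A + N = B + P) :
    (trace (P * cfc (fun x : ℝ => x / (t + x)) A)).re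
      - (trace (P * cfc (fun x : ℝ => x / (t + x)) B)).re ≤
      (trace (P * cfc (fun x : ℝ => x / (t + x)) P)).re := by
  refine (half ht hA hB hN hP e).trans ?_
  refine (mul_le_mul_of_nonneg_left (second_core ht hB hP) ht.le).trans (le_of_eq ?_)
  rw [k_eq ht hP, t_inv ht]
  simp only [mul_sub, mul_one, trace_sub, Complex.sub_re, mul_smul_comm, trace_smul,
    Complex.smul_re, smul_eq_mul]
  field_simp

theorem tr_sgn_le {Q T : Matrix n n ℂ} (hQ : Q.PosSemidef) (hQ1 : (1 - Q).PosSemidef)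
    (hT : T.IsHermitian) :
    (trace (Q * T)).re - (trace ((1 - Q) * T)).re ≤ (trace (matAbs T)).re := by
  have hs : IsSelfAdjoint T := hT
  have e1 : (matAbs T - T).PosSemidef := by
    have : matAbs T - T = cfc (fun x : ℝ => |x| - x) T := by
      rw [cfc_sub _ _ T (co _ _) (co _ _), cfc_id' ℝ T, matAbs_eq hT]
    rw [this]
    exact cfc_psd fun x => sub_nonneg.2 (le_abs_self x)
  have e2 : (matAbs T + T).PosSemidef := by
    have : matAbs T + T = cfc (fun x : ℝ => |x| + x) T := by
      rw [cfc_add T _ _ (co _ _) (co _ _), cfc_id' ℝ T, matAbs_eq hT]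
    rw [this]
    exact cfc_psd fun x => by linarith [neg_abs_le x]
  have h1 := tr_mul_nonneg hQ e1
  have h2 := tr_mul_nonneg hQ1 e2
  simp only [mul_sub, mul_add, sub_mul, one_mul, trace_sub, trace_add, Complex.sub_re,
    Complex.add_re] at *
  linarith

theorem jordan {S : Matrix n n ℂ} (hS : S.IsHermitian) :
    ∃ P N Q : Matrix n n ℂ, P.PosSemidef ∧ N.PosSemidef ∧ Q.PosSemidef ∧ (1 - Q).PosSemidef ∧
      S = P - N ∧ matAbs S = P + N ∧ Q * S = P ∧
      ∀ f : ℝ → ℝ, f 0 = 0 → cfc f (matAbs S) = cfc f P + cfc f N ∧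
        matAbs S * cfc f (matAbs S) = P * cfc f P + N * cfc f N := by
  have hs : IsSelfAdjoint S := hS
  refine ⟨cfc (fun x : ℝ => max x 0) S, cfc (fun x : ℝ => max (-x) 0) S,
    cfc (fun x : ℝ => if 0 < x then 1 else 0) S, cfc_psd fun x => le_max_right _ _,
    cfc_psd fun x => le_max_right _ _, cfc_psd fun x => by split_ifs <;> norm_num,
    ?_, ?_, ?_, ?_, ?_⟩
  · rw [← cfc_one ℝ S, ← cfc_sub _ _ S (co _ _) (co _ _)]
    exact cfc_psd fun x => by simp only [Pi.one_apply]; split_ifs <;> norm_num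
  · rw [← cfc_sub _ _ S (co _ _) (co _ _)]
    conv_lhs => rw [← cfc_id' ℝ S]
    congr 1; ext x
    rcases le_total 0 x with h | h <;> simp [h]
  · rw [← cfc_add S _ _ (co _ _) (co _ _), matAbs_eq hS]
    congr 1; ext x
    rcases le_total 0 x with h | h <;> simp [h, abs_of_nonneg, abs_of_nonpos]
  · have : cfc (fun x : ℝ => if 0 < x then (1 : ℝ) else 0) S * S =
        cfc (fun x : ℝ => if 0 < x then (1 : ℝ) else 0) S * cfc (fun x : ℝ => x) S := by
      rw [cfc_id' ℝ S]
    rw [this, ← cfc_mul _ _ S (co _ _) (co _ _)]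
    congr 1; ext x
    split_ifs with h
    · simp [h.le]
    · simp [not_lt.1 h]
  · intro f hf
    rw [matAbs_eq hS]
    simp only [cfc_cfc _ _ hS]
    rw [← cfc_mul _ _ S (co _ _) (co _ _), ← cfc_mul _ _ S (co _ _) (co _ _),
      ← cfc_mul _ _ S (co _ _) (co _ _), ← cfc_add S _ _ (co _ _) (co _ _),
      ← cfc_add S _ _ (co _ _) (co _ _)]
    constructor
    · congr 1; ext x
      rcases le_total 0 x with h | h <;> simp [h, hf, abs_of_nonneg, abs_of_nonpos]
    · congr 1; ext x
      rcases le_total 0 x with h | h <;> simp [h, hf, abs_of_nonneg, abs_of_nonpos]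

theorem main_re {p : ℝ} (hp1 : 1 < p) (hp2 : p ≤ 2)
    {A B : Matrix n n ℂ} (hA : A.PosSemidef) (hB : B.PosSemidef) :
    (trace (cfc (fun x : ℝ => x ^ p) (matAbs (A - B)))).re ≤
        (trace (matAbs (cfc (fun x : ℝ => x ^ p) A - cfc (fun x : ℝ => x ^ p) B))).re ∧
      (trace ((A - B) *
          (cfc (fun x : ℝ => x ^ (p - 1)) A - cfc (fun x : ℝ => x ^ (p - 1)) B))).re ≤
        (trace (cfc (fun x : ℝ => x ^ p) (matAbs (A - B)))).re := by
  have hS : (A - B).IsHermitian := hA.isHermitian.sub hB.isHermitian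
  obtain ⟨P, N, Q, hP, hN, hQ, hQ1, e1, e2, e3, e4⟩ := jordan hS
  have hM : (matAbs (A - B)).PosSemidef := e2 ▸ hP.add hN
  have eAB : A + N = B + P := by
    rw [← sub_eq_zero] at e1 ⊢
    rw [← e1]; abel
  have hr : 0 < p - 1 := by linarith
  have hr1 : p - 1 ≤ 1 := by linarith
  constructor
  · have hT := (cfc_herm (fun x : ℝ => x ^ p) A).sub (cfc_herm (fun x : ℝ => x ^ p) B)
    refine le_trans ?_ (tr_sgn_le hQ hQ1 hT)
    have key := key_mat hA hB hM ((Q - (1 - Q)) * A) (-((Q - (1 - Q)) * B))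
      (-(matAbs (A - B))) ?_ hr hr1
    · rw [rpow_split hA hp1, rpow_split hB hp1, rpow_split hM hp1]
      simp only [mul_sub, sub_mul, one_mul, neg_mul, trace_sub, trace_neg, Complex.sub_re,
        Complex.neg_re, mul_assoc] at *
      linarith
    · intro t ht
      have k0 : ∀ {X : Matrix n n ℂ}, X.PosSemidef → X * cfc (fun x : ℝ => x / (t + x)) X =
          X - t • cfc (fun x : ℝ => x / (t + x)) X := by
        intro X hX
        rw [k_eq ht hX, mul_sub, mul_smul_comm, mul_res ht hX, mul_one]
      have a1 := half_first ht hA hB hP hN hQ hQ1 eAB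
      have a2 := half_first ht hB hA hN hP hQ1 (by simpa using hQ) eAB.symm
      have a3 := congrArg (fun X => (trace X).re) (e4 (fun x : ℝ => x / (t + x)) (by simp)).1
      have a4 := congrArg (fun X => (trace X).re) e3
      have a5 := congrArg (fun X => (trace X).re) e2
      have a6 := congrArg (fun X => (trace X).re) e1
      simp only [neg_mul, mul_assoc, k0 hA, k0 hB, k0 hM]
      simp only [mul_sub, sub_mul, one_mul, mul_smul_comm, trace_sub, trace_neg, trace_add,
        trace_smul, Complex.sub_re, Complex.add_re, Complex.smul_re, smul_eq_mul,
        Complex.neg_re] at *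
      nlinarith
  · have key := key_mat hA hB hM (-(A - B)) (A - B) (matAbs (A - B)) ?_ hr hr1
    · rw [rpow_split hM hp1]
      simp only [mul_sub, neg_mul, trace_sub, trace_neg, Complex.sub_re, Complex.neg_re] at *
      linarith
    · intro t ht
      have a1 := half_second ht hA hB hP hN eAB
      have a2 := half_second ht hB hA hN hP eAB.symm
      rw [(e4 (fun x : ℝ => x / (t + x)) (by simp)).2, e1]
      simp only [neg_mul, sub_mul, trace_sub, trace_neg, trace_add, Complex.sub_re,
        Complex.add_re, Complex.neg_re] at *
      linarith

end helpers

theorem stmt_18 {n : Type*} [Fintype n] [DecidableEq n] (p : ℝ) (hp1 : 1 ≤ p) (hp2 : p ≤ 2)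
    (A B : Matrix n n ℂ) (hA : A.PosSemidef) (hB : B.PosSemidef) :
    Matrix.trace (cfc (fun x : ℝ => x ^ p) (matAbs (A - B))) ≤
        Matrix.trace (matAbs (cfc (fun x : ℝ => x ^ p) A - cfc (fun x : ℝ => x ^ p) B)) ∧
      Matrix.trace ((A - B) *
          (cfc (fun x : ℝ => x ^ (p - 1)) A - cfc (fun x : ℝ => x ^ (p - 1)) B)) ≤
        Matrix.trace (cfc (fun x : ℝ => x ^ p) (matAbs (A - B))) := by
  have hS : (A - B).IsHermitian := hA.isHermitian.sub hB.isHermitian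
  have hsA : IsSelfAdjoint A := hA.isHermitian
  have hsB : IsSelfAdjoint B := hB.isHermitian
  have hsM : IsSelfAdjoint (matAbs (A - B)) := cfc_herm _ _
  rcases hp1.eq_or_lt with rfl | hp
  · simp only [Real.rpow_one, sub_self, Real.rpow_zero]
    rw [cfc_id' ℝ A, cfc_id' ℝ B, cfc_id' ℝ (matAbs (A - B)), cfc_const_one ℝ A,
      cfc_const_one ℝ B]
    refine ⟨le_rfl, ?_⟩
    simp only [sub_self, mul_zero, trace_zero]
    rw [matAbs_eq hS]
    exact (cfc_psd fun x => abs_nonneg x).trace_nonneg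
  · obtain ⟨h1, h2⟩ := main_re hp hp2 hA hB
    have i1 := tr_im (cfc_herm (fun x : ℝ => x ^ p) (matAbs (A - B)))
    refine ⟨Complex.le_def.2 ⟨h1, ?_⟩, Complex.le_def.2 ⟨h2, ?_⟩⟩
    · rw [i1]
      exact (tr_im (cfc_herm _ _)).symm
    · rw [i1]
      exact tr_mul_im hS ((cfc_herm _ _).sub (cfc_herm _ _))
end
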